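/- arXiv:0707.2337 — 4 statements merged into one kernel-verified Lean document; each statement's English description precedes it below -/
import Mathlib

section
/- Let A be a (possibly noncommutative) ring with 1, let I be a finite index type, and let p, q : I → A be families of elements such that the p(n) are orthogonal idempotents (p(n)·p(m) equals p(n) if n = m and 0 otherwise), Σₙ p(n) = 1, and p(n)·q(m) + q(n)·p(m) equals q(n) if n = m and 0 otherwise, for all n, m ∈ I. Define ξ := Σ_{(n,m) : n ≠ m} p(m)·q(n)·p(n). Then for every i ∈ I one has q(i) = ξ·p(i) − p(i)·ξ, i.e. q(i) = [ξ, p(i)]. -/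
/-- If `a` is idempotent and `a * b + b * a = b`, then `a * b * a = 0`. -/
theorem IsIdempotentElem.mul_mul_self_eq_zero {A : Type*} [Ring A] {a b : A}
    (ha : IsIdempotentElem a) (hab : a * b + b * a = b) : a * b * a = 0 := by
  have h : a * (a * b + b * a) = a * b := by rw [hab]
  rw [mul_add, ← mul_assoc, ha.eq, ← mul_assoc] at h
  exact left_eq_add.mp h.symm

/-- Let `A` be a ring with `1`, `I` a finite index type, and `p q : I → A` families such
that the `p n` are orthogonal idempotents summing to `1` and
`p n * q m + q n * p m = δ_{n,m} q n`.  Put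
`ξ := ∑_{(n,m), n ≠ m} p m * q n * p n`.  Then `q i = [ξ, p i] = ξ * p i - p i * ξ`
for every `i`. -/
theorem commutator_formula_off_diagonal
    {A : Type*} [Ring A] {I : Type*} [Fintype I] [DecidableEq I]
    (p q : I → A)
    (hp : ∀ n m, p n * p m = if n = m then p n else 0)
    (hsum : ∑ n, p n = 1)
    (hpq : ∀ n m, p n * q m + q n * p m = if n = m then q n else 0)
    (ξ : A)
    (hξ : ξ = ∑ nm ∈ Finset.univ.filter (fun nm : I × I => nm.1 ≠ nm.2),
      p nm.2 * q nm.1 * p nm.1)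
    (i : I) :
    q i = ξ * p i - p i * ξ := by
  have hidem (n : I) : p n * p n = p n := by simpa using hp n n
  have hdiag (n : I) : p n * q n * p n = 0 :=
    IsIdempotentElem.mul_mul_self_eq_zero (hidem n) (by simpa using hpq n n)
  have hξ' : ξ = ∑ n, q n * p n := by
    rw [hξ, Finset.sum_filter_of_ne, Fintype.sum_prod_type]
    · refine Finset.sum_congr rfl fun n _ => ?_
      simp only [mul_assoc]
      rw [← Finset.sum_mul, hsum, one_mul]
    · rintro ⟨n, m⟩ - h (rfl : n = m)
      exact h (hdiag n)
  have hright : ξ * p i = q i * p i := by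
    simp [hξ', Finset.sum_mul, mul_assoc, hp]
  have hleft : p i * ξ = q i * p i - q i := by
    have hterm (n : I) : p i * (q n * p n) = (if i = n then q i * p i else 0) - q i * p n := by
      rw [← mul_assoc, eq_sub_of_add_eq (hpq i n), sub_mul, mul_assoc (q i), hidem]
      split_ifs with h
      · rw [h]
      · rw [zero_mul]
    rw [hξ', Finset.mul_sum, Finset.sum_congr rfl fun n _ => hterm n, Finset.sum_sub_distrib,
      ← Finset.mul_sum, hsum]
    simp
  rw [hright, hleft, sub_sub_cancel]
end

section
/- Let G be a group in which every element has a unique square root (for every g ∈ G there is a unique h ∈ G with h·h = g), and let θ : G → G be a group homomorphism. If ξ ∈ G satisfies ξ·θ(ξ) = 1, then the unique square root η of ξ satisfies θ(η) = η⁻¹, and consequently ξ = η·θ(η)⁻¹. -/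
/-- Let `G` be a group in which every element has a unique square root, and let
`θ : G → G` be a group homomorphism.  If `ξ * θ ξ = 1` then the unique square root `η`
of `ξ` satisfies `θ η = η⁻¹`, and consequently `ξ = η * (θ η)⁻¹`. -/
theorem sqrt_of_theta_inverse {G : Type*} [Group G]
    (hsq : ∀ g : G, ∃! h : G, h * h = g)
    (θ : G →* G) (ξ η : G) (hη : η * η = ξ) (hξ : ξ * θ ξ = 1) :
    θ η = η⁻¹ ∧ ξ = η * (θ η)⁻¹ := by
  have h : θ η = η⁻¹ := by
    refine (hsq ξ⁻¹).unique ?_ ?_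
    · rw [← map_mul, hη]
      exact eq_inv_of_mul_eq_one_right hξ
    · rw [← mul_inv_rev, hη]
  exact ⟨h, by rw [h, inv_inv, hη]⟩
end

section
/- Let (𝔞, δ) be a finite-dimensional Lie bialgebra over a field k and let 𝔇(𝔞) = 𝔞 ⊕ 𝔞* be its double. Then the canonical symmetric bilinear form ⟨(x,ξ),(y,η)⟩ := ξ(y) + η(x) on 𝔇(𝔞) is invariant for the double bracket: for all a, b, c ∈ 𝔇(𝔞), ⟨⁅a,b⁆, c⟩ = ⟨a, ⁅b,c⁆⟩. In particular 𝔞 and 𝔞* are isotropic subspaces of (𝔇(𝔞), ⟨·,·⟩). -/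
open TensorProduct

section LieBialgebraDouble

variable (k : Type*) [Field k] (V : Type*) [LieRing V] [LieAlgebra k V]

/-- The bracket `⁅ξ,η⁆_*` on the dual space induced by a cobracket `δ`:
`⁅ξ,η⁆_*(x) = (ξ ⊗ η)(δ x)`. -/
noncomputable def bStar (δ : V →ₗ[k] V ⊗[k] V) (ξ η : Module.Dual k V) :
    Module.Dual k V :=
  (TensorProduct.lid k k).toLinearMap ∘ₗ TensorProduct.map ξ η ∘ₗ δ

/-- The coadjoint action of `V` on its dual: `(ad*_x ξ)(y) = -ξ ⁅x,y⁆`. -/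
noncomputable def coad (x : V) (ξ : Module.Dual k V) : Module.Dual k V :=
  - (ξ ∘ₗ (LieAlgebra.ad k V x : V →ₗ[k] V))

/-- The coadjoint action of the dual on `V` (using `dim V < ∞` to identify `V` with its
double dual): it is characterized by `η (coadStar δ ξ x) = -⁅ξ,η⁆_*(x)` for all `η`. -/
noncomputable def coadStar (δ : V →ₗ[k] V ⊗[k] V) (ξ : Module.Dual k V) (x : V) : V :=
  - (TensorProduct.lid k V ((TensorProduct.map ξ LinearMap.id) (δ x)))

/-- The bracket of the double `𝔇(𝔞) = 𝔞 ⊕ 𝔞*`: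
`⁅(x,ξ),(y,η)⁆ = (⁅x,y⁆ + ad̲*_ξ y − ad̲*_η x, ⁅ξ,η⁆_* + ad*_x η − ad*_y ξ)`. -/
noncomputable def doubleBracket (δ : V →ₗ[k] V ⊗[k] V)
    (u v : V × Module.Dual k V) : V × Module.Dual k V :=
  (⁅u.1, v.1⁆ + coadStar k V δ u.2 v.1 - coadStar k V δ v.2 u.1,
   bStar k V δ u.2 v.2 + coad k V u.1 v.2 - coad k V v.1 u.2)

/-- The canonical symmetric bilinear form on the double:
`⟨(x,ξ),(y,η)⟩ = ξ(y) + η(x)`. -/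
noncomputable def doubleForm (u v : V × Module.Dual k V) : k :=
  u.2 v.1 + v.2 u.1

end LieBialgebraDouble

theorem apply_coadStar {k : Type*} [Field k] {V : Type*} [LieRing V] [LieAlgebra k V]
    (δ : V →ₗ[k] V ⊗[k] V) (ξ η : Module.Dual k V) (x : V) :
    η (coadStar k V δ ξ x) = -bStar k V δ ξ η x := by
  have h (t : V ⊗[k] V) :
      η (TensorProduct.lid k V (TensorProduct.map ξ LinearMap.id t)) =
        TensorProduct.lid k k (TensorProduct.map ξ η t) := by
    induction t with
    | zero => simp
    | tmul a b => simp
    | add a b ha hb => simp only [map_add, ha, hb]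
  simp [coadStar, bStar, h]

theorem bStar_antisymm {k : Type*} [Field k] {V : Type*} [LieRing V] [LieAlgebra k V]
    (δ : V →ₗ[k] V ⊗[k] V)
    (hantisym : ∀ x : V, (TensorProduct.comm k V V) (δ x) = - δ x)
    (ξ η : Module.Dual k V) (x : V) :
    bStar k V δ ξ η x = -bStar k V δ η ξ x := by
  have h (t : V ⊗[k] V) :
      TensorProduct.lid k k (TensorProduct.map ξ η (TensorProduct.comm k V V t)) =
        TensorProduct.lid k k (TensorProduct.map η ξ t) := by
    induction t with
    | zero => simp
    | tmul a b => simp [mul_comm]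
    | add a b ha hb => simp only [map_add, ha, hb]
  have := h (δ x)
  rw [hantisym, map_neg, map_neg] at this
  simp [bStar, ← this]

/-- Let `(𝔞, δ)` be a finite-dimensional Lie bialgebra over a field `k` and
`𝔇(𝔞) = 𝔞 ⊕ 𝔞*` its double.  The canonical symmetric bilinear form
`⟨(x,ξ),(y,η)⟩ = ξ(y) + η(x)` is invariant for the double bracket, and `𝔞` and `𝔞*`
are isotropic subspaces. -/
theorem double_form_invariant
    {k : Type*} [Field k] {V : Type*} [LieRing V] [LieAlgebra k V]
    [FiniteDimensional k V]
    (δ : V →ₗ[k] V ⊗[k] V)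
    (hantisym : ∀ x : V, (TensorProduct.comm k V V) (δ x) = - δ x)
    (hjacobi : ∀ ξ η ζ : Module.Dual k V,
      bStar k V δ (bStar k V δ ξ η) ζ + bStar k V δ (bStar k V δ η ζ) ξ +
        bStar k V δ (bStar k V δ ζ ξ) η = 0)
    (hcocycle : ∀ x y : V, δ ⁅x, y⁆ = ⁅x, δ y⁆ - ⁅y, δ x⁆) :
    (∀ a b c : V × Module.Dual k V,
      doubleForm k V (doubleBracket k V δ a b) c = doubleForm k V a (doubleBracket k V δ b c)) ∧
    (∀ x y : V, doubleForm k V (x, (0 : Module.Dual k V)) (y, 0) = 0) ∧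
    (∀ ξ η : Module.Dual k V, doubleForm k V ((0 : V), ξ) (0, η) = 0) := by
  refine ⟨?_, by simp [doubleForm], by simp [doubleForm]⟩
  rintro ⟨x, ξ⟩ ⟨y, η⟩ ⟨z, ζ⟩
  have hyx : ⁅y, x⁆ = -⁅x, y⁆ := (lie_skew y x).symm
  have hzx : ⁅z, x⁆ = -⁅x, z⁆ := (lie_skew z x).symm
  simp only [doubleForm, doubleBracket, coad, LinearMap.add_apply, LinearMap.sub_apply,
    LinearMap.neg_apply, LinearMap.comp_apply, LieAlgebra.ad_apply, map_add, map_sub,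
    apply_coadStar, hyx, hzx, map_neg]
  rw [bStar_antisymm δ hantisym η ξ z, bStar_antisymm δ hantisym ζ ξ y]
  ring
end

section
/- For integers n, m ≥ 0, let 𝔱_n be the infinitesimal braid Lie algebra over ℚ. For every partially defined map φ from {1,…,m} to {1,…,n} (i.e. a map φ : D_φ → {1,…,n} defined on a subset D_φ ⊆ {1,…,m}), the assignment t_{ij} ↦ Σ_{i' ∈ φ⁻¹(i), j' ∈ φ⁻¹(j)} t_{i'j'} (the sum being 0 if φ⁻¹(i) or φ⁻¹(j) is empty) extends to a well-defined Lie algebra homomorphism 𝔱_n → 𝔱_m. -/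
/-- Index type for the generators `t_{ij}`, `i ≠ j`, of the infinitesimal braid Lie
algebra on `n` strands. -/
def tGenIdx (n : ℕ) : Type := {p : Fin n × Fin n // p.1 ≠ p.2}

/-- The defining relations of the infinitesimal braid Lie algebra `𝔱_n`:
`t_{ij} = t_{ji}`, `⁅t_{ij}, t_{ik} + t_{jk}⁆ = 0` for `i, j, k` distinct, and
`⁅t_{ij}, t_{kl}⁆ = 0` for `i, j, k, l` distinct. -/
def tRels (n : ℕ) : Set (FreeLieAlgebra ℚ (tGenIdx n)) :=
  {x | (∃ (i j : Fin n) (h : i ≠ j),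
          x = FreeLieAlgebra.of ℚ (⟨(i, j), h⟩ : tGenIdx n) -
                FreeLieAlgebra.of ℚ (⟨(j, i), h.symm⟩ : tGenIdx n)) ∨
       (∃ (i j l : Fin n) (hij : i ≠ j) (hil : i ≠ l) (hjl : j ≠ l),
          x = ⁅FreeLieAlgebra.of ℚ (⟨(i, j), hij⟩ : tGenIdx n),
               FreeLieAlgebra.of ℚ (⟨(i, l), hil⟩ : tGenIdx n) +
                 FreeLieAlgebra.of ℚ (⟨(j, l), hjl⟩ : tGenIdx n)⁆) ∨
       (∃ (i j l m : Fin n) (hij : i ≠ j) (hlm : l ≠ m),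
          i ≠ l ∧ i ≠ m ∧ j ≠ l ∧ j ≠ m ∧
          x = ⁅FreeLieAlgebra.of ℚ (⟨(i, j), hij⟩ : tGenIdx n),
               FreeLieAlgebra.of ℚ (⟨(l, m), hlm⟩ : tGenIdx n)⁆)}

/-- The Lie ideal generated by the defining relations of `𝔱_n`. -/
noncomputable def tIdeal (n : ℕ) : LieIdeal ℚ (FreeLieAlgebra ℚ (tGenIdx n)) :=
  LieSubmodule.lieSpan ℚ _ (tRels n)

/-- The infinitesimal braid Lie algebra `𝔱_n` over `ℚ`: the quotient of the free Lie
algebra on the `t_{ij}` (`i ≠ j`) by the ideal generated by the defining relations. -/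
abbrev tAlg (n : ℕ) := FreeLieAlgebra ℚ (tGenIdx n) ⧸ tIdeal n

/-- The image `t_{ij}` of a generator in `𝔱_n` (and `0` if `i = j`). -/
noncomputable def tGen (n : ℕ) (i j : Fin n) : tAlg n :=
  if h : i ≠ j then
    LieSubmodule.Quotient.mk' (tIdeal n) (FreeLieAlgebra.of ℚ (⟨(i, j), h⟩ : tGenIdx n))
  else 0

/-- A Lie algebra homomorphism vanishing on a Lie ideal factors through the quotient. -/
theorem LieIdeal.exists_quotient_lift {R L L' : Type*} [CommRing R] [LieRing L] [LieAlgebra R L]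
    [LieRing L'] [LieAlgebra R L'] (I : LieIdeal R L) (F : L →ₗ⁅R⁆ L') (h : I ≤ F.ker) :
    ∃ G : (L ⧸ I) →ₗ⁅R⁆ L', ∀ x, G (LieSubmodule.Quotient.mk' I x) = F x := by
  have h' : I.toSubmodule ≤ LinearMap.ker (F : L →ₗ[R] L') := fun x hx => h hx
  refine ⟨{ I.toSubmodule.liftQ (F : L →ₗ[R] L') h' with
    map_lie' := ?_ }, fun x => rfl⟩
  intro x y
  obtain ⟨x, rfl⟩ := LieSubmodule.Quotient.surjective_mk' I x
  obtain ⟨y, rfl⟩ := LieSubmodule.Quotient.surjective_mk' I y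
  exact F.map_lie x y

theorem tGen_of_ne {n : ℕ} {i j : Fin n} (h : i ≠ j) :
    tGen n i j = LieSubmodule.Quotient.mk' (tIdeal n)
      (FreeLieAlgebra.of ℚ (⟨(i, j), h⟩ : tGenIdx n)) :=
  dif_pos h

theorem mk_eq_zero_of_mem_tRels {n : ℕ} {x : FreeLieAlgebra ℚ (tGenIdx n)} (hx : x ∈ tRels n) :
    LieSubmodule.Quotient.mk' (tIdeal n) x = 0 :=
  LieSubmodule.Quotient.mk_eq_zero _ |>.2 (LieSubmodule.subset_lieSpan hx)

theorem tGen_comm {n : ℕ} (i j : Fin n) : tGen n i j = tGen n j i := by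
  by_cases h : i = j
  · rw [h]
  · rw [tGen_of_ne h, tGen_of_ne (Ne.symm h), ← sub_eq_zero, ← map_sub]
    exact mk_eq_zero_of_mem_tRels (Or.inl ⟨i, j, h, rfl⟩)

theorem tGen_lie_add {n : ℕ} {i j k : Fin n} (hij : i ≠ j) (hik : i ≠ k) (hjk : j ≠ k) :
    ⁅tGen n i j, tGen n i k + tGen n j k⁆ = 0 := by
  rw [tGen_of_ne hij, tGen_of_ne hik, tGen_of_ne hjk]
  exact mk_eq_zero_of_mem_tRels (Or.inr (Or.inl ⟨i, j, k, hij, hik, hjk, rfl⟩))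

theorem tGen_lie_tGen {n : ℕ} {i j k l : Fin n} (hij : i ≠ j) (hkl : k ≠ l) (hik : i ≠ k)
    (hil : i ≠ l) (hjk : j ≠ k) (hjl : j ≠ l) : ⁅tGen n i j, tGen n k l⁆ = 0 := by
  rw [tGen_of_ne hij, tGen_of_ne hkl]
  exact mk_eq_zero_of_mem_tRels
    (Or.inr (Or.inr ⟨i, j, k, l, hij, hkl, hik, hil, hjk, hjl, rfl⟩))

/-- The universal property of `𝔱_n`: a family satisfying the infinitesimal braid relations
extends to a Lie algebra homomorphism. -/
theorem exists_tAlg_lift {n : ℕ} {L : Type*} [LieRing L] [LieAlgebra ℚ L] (g : Fin n → Fin n → L)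
    (hsymm : ∀ i j, i ≠ j → g i j = g j i)
    (hadd : ∀ i j k, i ≠ j → i ≠ k → j ≠ k → ⁅g i j, g i k + g j k⁆ = 0)
    (hcomm : ∀ i j k l, i ≠ j → k ≠ l → i ≠ k → i ≠ l → j ≠ k → j ≠ l → ⁅g i j, g k l⁆ = 0) :
    ∃ Φ : tAlg n →ₗ⁅ℚ⁆ L, ∀ i j, i ≠ j → Φ (tGen n i j) = g i j := by
  let F : FreeLieAlgebra ℚ (tGenIdx n) →ₗ⁅ℚ⁆ L :=
    FreeLieAlgebra.lift ℚ fun p => g p.1.1 p.1.2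
  let x (i j : Fin n) (h : i ≠ j) : FreeLieAlgebra ℚ (tGenIdx n) :=
    FreeLieAlgebra.of ℚ (⟨(i, j), h⟩ : tGenIdx n)
  have hF (i j : Fin n) (h : i ≠ j) : F (x i j h) = g i j :=
    FreeLieAlgebra.lift_of_apply _ _
  have hker : tIdeal n ≤ F.ker := by
    refine LieSubmodule.lieSpan_le.2 ?_
    rintro _ (⟨i, j, h, rfl⟩ | ⟨i, j, k, hij, hik, hjk, rfl⟩ |
      ⟨i, j, k, l, hij, hkl, hik, hil, hjk, hjl, rfl⟩)
    · change F (x i j h - x j i h.symm) = 0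
      rw [map_sub, hF, hF, hsymm i j h, sub_self]
    · change F ⁅x i j hij, x i k hik + x j k hjk⁆ = 0
      rw [LieHom.map_lie, map_add, hF, hF, hF,
        hadd i j k hij hik hjk]
    · change F ⁅x i j hij, x k l hkl⁆ = 0
      rw [LieHom.map_lie, hF, hF,
        hcomm i j k l hij hkl hik hil hjk hjl]
  obtain ⟨Φ, hΦ⟩ := LieIdeal.exists_quotient_lift (tIdeal n) F hker
  exact ⟨Φ, fun i j h => by rw [tGen_of_ne h]; exact (hΦ _).trans (hF i j h)⟩

/-- The sum of the `t_{ab}` over `a ∈ A` and `b ∈ B`. -/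
noncomputable def tBlock {m : ℕ} (A B : Finset (Fin m)) : tAlg m :=
  ∑ a ∈ A, ∑ b ∈ B, tGen m a b

theorem tBlock_comm {m : ℕ} (A B : Finset (Fin m)) : tBlock A B = tBlock B A := by
  rw [tBlock, Finset.sum_comm]
  exact Finset.sum_congr rfl fun b _ => Finset.sum_congr rfl fun a _ => tGen_comm a b

theorem tBlock_lie_eq_zero {m : ℕ} {A B : Finset (Fin m)} {x : tAlg m}
    (h : ∀ a ∈ A, ∀ b ∈ B, ⁅tGen m a b, x⁆ = 0) : ⁅tBlock A B, x⁆ = 0 := by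
  rw [tBlock, sum_lie]
  refine Finset.sum_eq_zero fun a ha => ?_
  rw [sum_lie]
  exact Finset.sum_eq_zero fun b hb => h a ha b hb

/-- Only the row of `a` in a block `A × C` contributes to the bracket with `t_{ab}`. -/
theorem tGen_lie_tBlock {m : ℕ} {A C : Finset (Fin m)} {a b : Fin m} (ha : a ∈ A)
    (hb : b ∉ A) (haC : a ∉ C) (hbC : b ∉ C) (hAC : Disjoint A C) :
    ⁅tGen m a b, tBlock A C⁆ = ∑ c ∈ C, ⁅tGen m a b, tGen m a c⁆ := by
  rw [tBlock, lie_sum, Finset.sum_eq_single_of_mem a ha, lie_sum]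
  intro a' ha' hne
  rw [lie_sum]
  exact Finset.sum_eq_zero fun c hc =>
    tGen_lie_tGen (ne_of_mem_of_not_mem ha hb) (Finset.disjoint_iff_ne.1 hAC a' ha' c hc)
      hne.symm (ne_of_mem_of_not_mem hc haC).symm (ne_of_mem_of_not_mem ha' hb).symm
      (ne_of_mem_of_not_mem hc hbC).symm

theorem tBlock_lie_add {m : ℕ} {A B C : Finset (Fin m)} (hAB : Disjoint A B)
    (hAC : Disjoint A C) (hBC : Disjoint B C) :
    ⁅tBlock A B, tBlock A C + tBlock B C⁆ = 0 := by
  refine tBlock_lie_eq_zero fun a ha b hb => ?_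
  have haB := Finset.disjoint_left.1 hAB ha
  have hbA := Finset.disjoint_right.1 hAB hb
  have haC := Finset.disjoint_left.1 hAC ha
  have hbC := Finset.disjoint_left.1 hBC hb
  rw [lie_add, tGen_lie_tBlock ha hbA haC hbC hAC, tGen_comm a b,
    tGen_lie_tBlock hb haB hbC haC hBC, ← Finset.sum_add_distrib]
  refine Finset.sum_eq_zero fun c hc => ?_
  rw [← lie_add, tGen_comm b a]
  exact tGen_lie_add (ne_of_mem_of_not_mem ha hbA) (ne_of_mem_of_not_mem hc haC).symm
    (ne_of_mem_of_not_mem hc hbC).symm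

theorem tBlock_lie_tBlock {m : ℕ} {A B C D : Finset (Fin m)} (hAB : Disjoint A B)
    (hCD : Disjoint C D) (hAC : Disjoint A C) (hAD : Disjoint A D) (hBC : Disjoint B C)
    (hBD : Disjoint B D) : ⁅tBlock A B, tBlock C D⁆ = 0 := by
  refine tBlock_lie_eq_zero fun a ha b hb => ?_
  rw [tBlock, lie_sum]
  refine Finset.sum_eq_zero fun c hc => ?_
  rw [lie_sum]
  rw [Finset.disjoint_iff_ne] at hAB hCD hAC hAD hBC hBD
  exact Finset.sum_eq_zero fun d hd => tGen_lie_tGen (hAB a ha b hb) (hCD c hc d hd)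
    (hAC a ha c hc) (hAD a ha d hd) (hBC b hb c hc) (hBD b hb d hd)

/-- For every partially defined map `φ` from `{1,…,m}` to `{1,…,n}` (encoded as
`f : Fin m → Option (Fin n)`, with `f i' = some i` meaning `i' ∈ D_φ` and `φ(i') = i`),
the assignment `t_{ij} ↦ Σ_{i' ∈ φ⁻¹(i), j' ∈ φ⁻¹(j)} t_{i'j'}` extends to a
well-defined Lie algebra homomorphism `𝔱_n → 𝔱_m`. -/
theorem t_insertion_morphism (n m : ℕ) (f : Fin m → Option (Fin n)) :
    ∃ Φ : tAlg n →ₗ⁅ℚ⁆ tAlg m,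
      ∀ (i j : Fin n), i ≠ j →
        Φ (tGen n i j) =
          ∑ p ∈ Finset.univ.filter
              (fun p : Fin m × Fin m => f p.1 = some i ∧ f p.2 = some j),
            tGen m p.1 p.2 := by
  let S (i : Fin n) : Finset (Fin m) := Finset.univ.filter fun a => f a = some i
  have hS {i j : Fin n} (h : i ≠ j) : Disjoint (S i) (S j) := by
    refine Finset.disjoint_filter.2 fun a _ hi hj => h ?_
    exact Option.some_injective _ (hi.symm.trans hj)
  obtain ⟨Φ, hΦ⟩ := exists_tAlg_lift (fun i j => tBlock (S i) (S j))
    (fun i j _ => tBlock_comm _ _)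
    (fun i j k hij hik hjk => tBlock_lie_add (hS hij) (hS hik) (hS hjk))
    (fun i j k l hij hkl hik hil hjk hjl =>
      tBlock_lie_tBlock (hS hij) (hS hkl) (hS hik) (hS hil) (hS hjk) (hS hjl))
  refine ⟨Φ, fun i j hij => ?_⟩
  rw [hΦ i j hij, tBlock, ← Finset.sum_product', ← Finset.filter_product,
    Finset.univ_product_univ]
end
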